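/- There exists a universal constant c > 0 such that, in the per-step LAZOa setup, if v ∈ ℝ^d satisfies ‖x_t − x_{t−1}‖ ≤ η‖v‖, then the LAZOa gradient estimator satisfies E_u[‖g(u)‖²] ≤ c·d·L² + (2d²D²η²/δ²)‖v‖² + 8d²D². -/

import Mathlib

open MeasureTheory

/-- The uniform probability measure on the closed unit ball of `ℝ^d`. -/
noncomputable def ballUniform (d : ℕ) : Measure (EuclideanSpace ℝ (Fin d)) :=
  (volume (Metric.closedBall (0 : EuclideanSpace ℝ (Fin d)) 1))⁻¹ •
    volume.restrict (Metric.closedBall (0 : EuclideanSpace ℝ (Fin d)) 1)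

/-- The uniform (rotation-invariant) probability measure on the unit sphere of `ℝ^d`,
realized as the pushforward of the uniform measure on the unit ball under the radial
projection `v ↦ v / ‖v‖`. -/
noncomputable def sphereUniform (d : ℕ) : Measure (EuclideanSpace ℝ (Fin d)) :=
  Measure.map (fun v => ‖v‖⁻¹ • v) (ballUniform d)

open ProbabilityTheory Filter
open scoped Real Topology NNReal

section Lipschitz

variable {E : Type*} [NormedAddCommGroup E] [NormedSpace ℝ E]

theorem LipschitzWith.abs_sub_rotation_le {G : E → ℝ} {K : ℝ≥0} (hG : LipschitzWith K G)
    (θ : ℝ) (p : E × E) :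
    |G (Real.cos θ • p.1 + Real.sin θ • p.2) - G p.1| ≤ 2 * K * |θ| * ‖p‖ := by
  have h := hG.dist_le_mul (Real.cos θ • p.1 + Real.sin θ • p.2) p.1
  rw [Real.dist_eq, dist_eq_norm] at h
  refine h.trans ?_
  have hc : |Real.cos θ - 1| ≤ |θ| := by
    simpa using Real.abs_cos_sub_cos_le θ 0
  have hs : |Real.sin θ| ≤ |θ| := Real.abs_sin_le_abs
  have h2 : ‖Real.cos θ • p.1 + Real.sin θ • p.2 - p.1‖ ≤ 2 * |θ| * ‖p‖ := by
    calc ‖Real.cos θ • p.1 + Real.sin θ • p.2 - p.1‖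
        = ‖(Real.cos θ - 1) • p.1 + Real.sin θ • p.2‖ := by congr 1; module
      _ ≤ |Real.cos θ - 1| * ‖p.1‖ + |Real.sin θ| * ‖p.2‖ := by
          refine (norm_add_le _ _).trans_eq ?_
          simp [norm_smul]
      _ ≤ |θ| * ‖p‖ + |θ| * ‖p‖ := by
          gcongr
          exacts [norm_fst_le p, norm_snd_le p]
      _ = 2 * |θ| * ‖p‖ := by ring
  calc (K : ℝ) * _ ≤ K * (2 * |θ| * ‖p‖) := by gcongr
    _ = _ := by ring

theorem LipschitzWith.mul_sub_rotation_sq_le {G : E → ℝ} {K : ℝ≥0} (hG : LipschitzWith K G)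
    {n : ℕ} (hn : n ≠ 0) (p : E × E) :
    (n * (G (Real.cos (π / n) • p.1 + Real.sin (π / n) • p.2) - G p.1)) ^ 2 ≤
      (2 * K * π) ^ 2 * ‖p‖ ^ 2 := by
  rw [← mul_pow]
  refine sq_le_sq' ?_ ?_ <;> [apply neg_le_of_abs_le; apply le_of_abs_le] <;>
  · have h := hG.abs_sub_rotation_le (π / n) p
    have hn' : (0 : ℝ) < n := by positivity
    rw [abs_mul, Nat.abs_cast]
    rw [abs_of_nonneg (by positivity : 0 ≤ π / n)] at h
    calc _ ≤ n * (2 * K * (π / n) * ‖p‖) := by gcongr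
      _ = _ := by field_simp

theorem DifferentiableAt.tendsto_mul_sub_rotation {G : E → ℝ} {p : E × E}
    (hd : DifferentiableAt ℝ G p.1) :
    Tendsto (fun n : ℕ ↦ n * (G (Real.cos (π / n) • p.1 + Real.sin (π / n) • p.2) - G p.1))
      atTop (𝓝 (π * fderiv ℝ G p.1 p.2)) := by
  have hpath : HasDerivAt (fun t : ℝ ↦ Real.cos t • p.1 + Real.sin t • p.2) p.2 0 := by
    simpa using ((Real.hasDerivAt_cos 0).smul_const p.1).fun_add
      ((Real.hasDerivAt_sin 0).smul_const p.2)
  have hcomp : HasDerivAt (fun t : ℝ ↦ G (Real.cos t • p.1 + Real.sin t • p.2))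
      (fderiv ℝ G p.1 p.2) 0 :=
    HasFDerivAt.comp_hasDerivAt (l := G) 0 (by simpa using hd.hasFDerivAt) hpath
  have hseq : Tendsto (fun n : ℕ ↦ π / (n : ℝ)) atTop (𝓝[≠] 0) := by
    refine tendsto_nhdsWithin_iff.2 ⟨tendsto_const_div_atTop_nhds_zero_nat π, ?_⟩
    filter_upwards [eventually_ne_atTop 0] with n hn
    have : (0 : ℝ) < n := by positivity
    exact (by positivity : π / (n : ℝ) ≠ 0)
  have h := (hcomp.tendsto_slope.comp hseq).const_mul π
  refine h.congr' ?_
  filter_upwards [eventually_ne_atTop 0] with n hn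
  have : (0 : ℝ) < n := by positivity
  simp [slope_def_field]
  field_simp

theorem LipschitzWith.norm_mul_comp_normalize {h : E → ℝ} {A B : ℝ≥0} (hA : LipschitzWith A h)
    (hB : ∀ u, ‖u‖ = 1 → |h u| ≤ B) :
    LipschitzWith (2 * A + B) fun x ↦ ‖x‖ * h (‖x‖⁻¹ • x) := by
  have hunit {x : E} (hx : x ≠ 0) : |h (‖x‖⁻¹ • x)| ≤ B := hB _ (by simp [norm_smul, hx])
  have hle (x : E) : |‖x‖ * h (‖x‖⁻¹ • x)| ≤ (2 * A + B) * ‖x‖ := by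
    rcases eq_or_ne x 0 with rfl | hx
    · simp
    rw [abs_mul, abs_norm, mul_comm]
    have : (0 : ℝ) ≤ 2 * A := by positivity
    have := hunit hx
    gcongr
    linarith
  refine LipschitzWith.of_dist_le_mul fun x y ↦ ?_
  rw [Real.dist_eq, dist_eq_norm]
  push_cast
  rcases eq_or_ne x 0 with rfl | hx
  · simpa using hle y
  rcases eq_or_ne y 0 with rfl | hy
  · simpa using hle x
  have hx' : 0 < ‖x‖ := norm_pos_iff.2 hx
  have hy' : 0 < ‖y‖ := norm_pos_iff.2 hy
  have hnn : |‖x‖ - ‖y‖| ≤ ‖x - y‖ := abs_norm_sub_norm_le x y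
  have hdir : ‖x‖ * ‖‖x‖⁻¹ • x - ‖y‖⁻¹ • y‖ ≤ 2 * ‖x - y‖ := by
    calc ‖x‖ * ‖‖x‖⁻¹ • x - ‖y‖⁻¹ • y‖ = ‖‖x‖ • (‖x‖⁻¹ • x - ‖y‖⁻¹ • y)‖ := by
          rw [norm_smul, norm_norm]
      _ = ‖(x - y) - ((‖x‖ - ‖y‖) * ‖y‖⁻¹) • y‖ := by
          rw [smul_sub, smul_smul, smul_smul, sub_mul, mul_inv_cancel₀ hx'.ne',
            mul_inv_cancel₀ hy'.ne']
          congr 1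
          module
      _ ≤ ‖x - y‖ + |‖x‖ - ‖y‖| := by
          refine (_root_.norm_sub_le _ _).trans_eq ?_
          rw [norm_smul, norm_mul, norm_inv, norm_norm, mul_assoc, inv_mul_cancel₀ hy'.ne',
            mul_one, Real.norm_eq_abs]
      _ ≤ 2 * ‖x - y‖ := by linarith
  have hh : |h (‖x‖⁻¹ • x) - h (‖y‖⁻¹ • y)| ≤ A * ‖‖x‖⁻¹ • x - ‖y‖⁻¹ • y‖ := by
    simpa [Real.dist_eq, dist_eq_norm] using hA.dist_le_mul (‖x‖⁻¹ • x) (‖y‖⁻¹ • y)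
  calc |‖x‖ * h (‖x‖⁻¹ • x) - ‖y‖ * h (‖y‖⁻¹ • y)|
      = |‖x‖ * (h (‖x‖⁻¹ • x) - h (‖y‖⁻¹ • y)) + (‖x‖ - ‖y‖) * h (‖y‖⁻¹ • y)| := by
        congr 1; ring
    _ ≤ ‖x‖ * |h (‖x‖⁻¹ • x) - h (‖y‖⁻¹ • y)| + |‖x‖ - ‖y‖| * |h (‖y‖⁻¹ • y)| := by
        refine (abs_add_le _ _).trans_eq ?_
        rw [abs_mul, abs_mul, abs_norm]
    _ ≤ ‖x‖ * (A * ‖‖x‖⁻¹ • x - ‖y‖⁻¹ • y‖) + ‖x - y‖ * B := by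
        gcongr
        exact hunit hy
    _ = A * (‖x‖ * ‖‖x‖⁻¹ • x - ‖y‖⁻¹ • y‖) + ‖x - y‖ * B := by ring
    _ ≤ A * (2 * ‖x - y‖) + ‖x - y‖ * B := by gcongr
    _ = (2 * A + B) * ‖x - y‖ := by ring

end Lipschitz

section Gaussian

variable {E : Type*} [NormedAddCommGroup E] [InnerProductSpace ℝ E] [FiniteDimensional ℝ E]
  [MeasurableSpace E] [BorelSpace E]

theorem stdGaussian_eq_withDensity :
    stdGaussian E = volume.withDensity fun x : E ↦
      ENNReal.ofReal ((2 * π) ^ (-(Module.finrank ℝ E / 2 : ℝ)) * Real.exp (-(‖x‖ ^ 2 / 2))) := by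
  set C : ℝ := (2 * π) ^ (-(Module.finrank ℝ E / 2 : ℝ)) with hC
  have hC0 : 0 < C := by positivity
  have hint : Integrable (fun x : E ↦ C * Real.exp (-(‖x‖ ^ 2 / 2))) := by
    have h := GaussianFourier.integrable_cexp_neg_mul_sq_norm_add (V := E) (b := 1 / 2)
      (by norm_num) 0 0
    refine (h.norm.const_mul C).congr (.of_forall fun x ↦ ?_)
    have : -(1 / 2 : ℂ) * (‖x‖ : ℂ) ^ 2 = ((-(‖x‖ ^ 2 / 2) : ℝ) : ℂ) := by push_cast; ring
    simp only [zero_mul, add_zero, this, Complex.norm_exp_ofReal]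
  have : IsFiniteMeasure (volume.withDensity fun x : E ↦
      ENNReal.ofReal (C * Real.exp (-(‖x‖ ^ 2 / 2)))) :=
    isFiniteMeasure_withDensity_ofReal hint.2
  refine Measure.ext_of_charFun ?_
  ext t
  rw [charFun_stdGaussian, charFun_apply,
    integral_withDensity_eq_integral_toReal_smul (by fun_prop) (by simp)]
  have h := GaussianFourier.integral_cexp_neg_mul_sq_norm_add (V := E) (b := 1 / 2)
    (by norm_num) Complex.I t
  have key : ∀ x : E, (ENNReal.ofReal (C * Real.exp (-(‖x‖ ^ 2 / 2)))).toReal •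
      Complex.exp (inner ℝ x t * Complex.I) =
      (C : ℂ) * Complex.exp (-(1 / 2) * ‖x‖ ^ 2 + Complex.I * inner ℝ t x) := by
    intro x
    rw [ENNReal.toReal_ofReal (by positivity), Complex.real_smul, Complex.ofReal_mul, mul_assoc,
      Complex.ofReal_exp, ← Complex.exp_add, real_inner_comm]
    congr 2
    push_cast
    ring
  simp_rw [key]
  rw [integral_const_mul, h, ← mul_assoc]
  have h1 : (π / (1 / 2 : ℂ)) ^ (Module.finrank ℝ E / 2 : ℂ) =
      (((2 * π) ^ (Module.finrank ℝ E / 2 : ℝ) : ℝ) : ℂ) := by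
    rw [Complex.ofReal_cpow (by positivity)]
    push_cast
    congr 1
    ring
  rw [h1, ← Complex.ofReal_mul, hC, ← Real.rpow_add (by positivity)]
  simp only [neg_add_cancel, Real.rpow_zero, Complex.ofReal_one, one_mul, Complex.I_sq]
  congr 1
  ring

theorem stdGaussian_absolutelyContinuous : stdGaussian E ≪ volume := by
  rw [stdGaussian_eq_withDensity]
  exact withDensity_absolutelyContinuous _ _

theorem integral_norm_sq_stdGaussian :
    ∫ x, ‖x‖ ^ 2 ∂(stdGaussian E) = Module.finrank ℝ E := by
  let b := stdOrthonormalBasis ℝ E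
  have hL (L : StrongDual ℝ E) : Integrable (fun x ↦ L x ^ 2) (stdGaussian E) :=
    (IsGaussian.memLp_dual (stdGaussian E) L 2 (by simp)).integrable_sq
  have hV (L : StrongDual ℝ E) : ∫ x, L x ^ 2 ∂(stdGaussian E) = ‖L‖ ^ 2 := by
    rw [← variance_dual_stdGaussian, variance_of_integral_eq_zero
      L.continuous.aemeasurable (integral_strongDual_stdGaussian L)]
  have h : ∀ x : E, ‖x‖ ^ 2 = ∑ i, (innerSL ℝ (b i) x) ^ 2 := fun x ↦ by
    simpa using (b.sum_sq_norm_inner_right x).symm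
  simp_rw [h]
  rw [integral_finsetSum _ fun i _ ↦ hL _]
  simp_rw [hV]
  simp [b]

theorem map_rotation_stdGaussian_prod (θ : ℝ) :
    ((stdGaussian E).prod (stdGaussian E)).map (ContinuousLinearMap.rotation θ) =
      (stdGaussian E).prod (stdGaussian E) :=
  IsGaussian.map_rotation_eq_self_of_forall_strongDual_eq_zero integral_strongDual_stdGaussian θ

theorem integrable_norm_sq_stdGaussian_prod :
    Integrable (fun p : E × E ↦ ‖p‖ ^ 2) ((stdGaussian E).prod (stdGaussian E)) :=
  (IsGaussian.memLp_id ((stdGaussian E).prod (stdGaussian E)) 2 (by simp)).norm.integrable_sq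

/-- A discretisation of the path of rotations from `x` to `-x`. -/
theorem integral_sq_sub_neg_le_rotation {G : E → ℝ} {K : ℝ≥0} (hG : LipschitzWith K G) {n : ℕ}
    (hn : n ≠ 0) :
    ∫ x, (G x - G (-x)) ^ 2 ∂(stdGaussian E) ≤
      ∫ p, (n * (G (Real.cos (π / n) • p.1 + Real.sin (π / n) • p.2) - G p.1)) ^ 2
        ∂((stdGaussian E).prod (stdGaussian E)) := by
  set γ := stdGaussian E
  have hGc := hG.continuous
  set F : E × E → ℝ := fun p ↦
    (n * (G (Real.cos (π / n) • p.1 + Real.sin (π / n) • p.2) - G p.1)) ^ 2 with hF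
  have hFc : Continuous F := by fun_prop
  have hFi : Integrable F (γ.prod γ) := by
    refine (integrable_norm_sq_stdGaussian_prod.const_mul ((2 * K * π) ^ 2)).mono'
      hFc.aestronglyMeasurable (.of_forall fun p ↦ ?_)
    rw [Real.norm_of_nonneg (sq_nonneg _)]
    exact hG.mul_sub_rotation_sq_le hn p
  have hmp (θ : ℝ) : MeasurePreserving (ContinuousLinearMap.rotation (E := E) θ)
      (γ.prod γ) (γ.prod γ) :=
    ⟨(ContinuousLinearMap.rotation θ).continuous.measurable, map_rotation_stdGaussian_prod θ⟩
  have hFk (k : ℕ) : Integrable (fun p ↦ F (ContinuousLinearMap.rotation (k * (π / n)) p))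
      (γ.prod γ) := (hmp _).integrable_comp_of_integrable hFi
  have hn' : (0 : ℝ) < n := by positivity
  let X (k : ℕ) (p : E × E) : E := Real.cos (k * (π / n)) • p.1 + Real.sin (k * (π / n)) • p.2
  have hstep (k : ℕ) (p : E × E) :
      F (ContinuousLinearMap.rotation (k * (π / n)) p) =
        n ^ 2 * (G (X (k + 1) p) - G (X k p)) ^ 2 := by
    rw [hF, ← mul_pow]
    simp only [ContinuousLinearMap.rotation_apply, X]
    congr 4
    rw [Nat.cast_add_one, add_one_mul, Real.cos_add, Real.sin_add]
    module
  have hpt (p : E × E) : (G p.1 - G (-p.1)) ^ 2 ≤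
      (n : ℝ)⁻¹ * ∑ k ∈ Finset.range n, F (ContinuousLinearMap.rotation (k * (π / n)) p) := by
    have htel := Finset.sum_range_sub (fun k ↦ G (X k p)) n
    have h0 : X 0 p = p.1 := by simp [X]
    have h1 : X n p = -p.1 := by
      have : (n : ℝ) * (π / n) = π := by field_simp
      simp [X, this]
    rw [h0, h1] at htel
    have hcs := sq_sum_le_card_mul_sum_sq (s := Finset.range n)
      (f := fun k ↦ G (X (k + 1) p) - G (X k p))
    rw [htel, Finset.card_range] at hcs
    simp_rw [hstep]
    rw [← Finset.mul_sum]
    calc (G p.1 - G (-p.1)) ^ 2 = (G (-p.1) - G p.1) ^ 2 := by ring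
      _ ≤ _ := hcs
      _ = _ := by field_simp
  calc ∫ x, (G x - G (-x)) ^ 2 ∂γ = ∫ p, (G p.1 - G (-p.1)) ^ 2 ∂(γ.prod γ) := by
        rw [integral_fun_fst (fun x ↦ (G x - G (-x)) ^ 2)]
        simp
    _ ≤ ∫ p, (n : ℝ)⁻¹ * ∑ k ∈ Finset.range n,
          F (ContinuousLinearMap.rotation (k * (π / n)) p) ∂(γ.prod γ) :=
        integral_mono_of_nonneg (.of_forall fun p ↦ sq_nonneg _)
          ((integrable_finsetSum _ fun k _ ↦ hFk k).const_mul _) (.of_forall hpt)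
    _ = ∫ p, F p ∂(γ.prod γ) := by
        rw [integral_const_mul, integral_finsetSum _ fun k _ ↦ hFk k]
        have (k : ℕ) : ∫ p, F (ContinuousLinearMap.rotation (k * (π / n)) p) ∂(γ.prod γ) =
            ∫ p, F p ∂(γ.prod γ) := by
          conv_rhs => rw [← map_rotation_stdGaussian_prod (k * (π / n))]
          exact (integral_map (by fun_prop) hFc.aestronglyMeasurable).symm
        simp_rw [this]
        simp [hn]

theorem integral_sq_sub_neg_le {G : E → ℝ} {K : ℝ≥0} (hG : LipschitzWith K G) :
    ∫ x, (G x - G (-x)) ^ 2 ∂(stdGaussian E) ≤ π ^ 2 * K ^ 2 := by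
  set γ := stdGaussian E
  have hGc := hG.continuous
  have hdiff : ∀ᵐ p ∂(γ.prod γ), DifferentiableAt ℝ G p.1 :=
    Measure.quasiMeasurePreserving_fst.ae
      (stdGaussian_absolutelyContinuous.ae_le hG.ae_differentiableAt)
  have hbound : Integrable (fun p : E × E ↦ (2 * K * π) ^ 2 * ‖p‖ ^ 2) (γ.prod γ) :=
    integrable_norm_sq_stdGaussian_prod.const_mul _
  have hlim : Tendsto (fun n : ℕ ↦ ∫ p,
      ((n + 1 : ℕ) * (G (Real.cos (π / (n + 1 : ℕ)) • p.1 + Real.sin (π / (n + 1 : ℕ)) • p.2) -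
        G p.1)) ^ 2 ∂(γ.prod γ)) atTop (𝓝 (∫ p, (π * fderiv ℝ G p.1 p.2) ^ 2 ∂(γ.prod γ))) := by
    refine tendsto_integral_of_dominated_convergence _
      (fun n ↦ Continuous.aestronglyMeasurable (by fun_prop)) hbound
      (fun n ↦ .of_forall fun p ↦ ?_) ?_
    · rw [Real.norm_of_nonneg (sq_nonneg _)]
      exact hG.mul_sub_rotation_sq_le n.succ_ne_zero p
    · filter_upwards [hdiff] with p hp
      exact (hp.tendsto_mul_sub_rotation.comp (tendsto_add_atTop_nat 1)).pow 2
  refine (ge_of_tendsto' hlim fun n ↦ integral_sq_sub_neg_le_rotation hG n.succ_ne_zero).trans ?_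
  have hK (x : E) : ‖fderiv ℝ G x‖ ≤ K := norm_fderiv_le_of_lipschitz ℝ hG
  have hmeas : Measurable fun p : E × E ↦ (π * fderiv ℝ G p.1 p.2) ^ 2 := by
    have : Measurable fun p : E × E ↦ fderiv ℝ G p.1 p.2 :=
      isBoundedBilinearMap_apply.continuous.measurable.comp
        (((measurable_fderiv ℝ G).comp measurable_fst).prodMk measurable_snd)
    exact (this.const_mul π).pow_const 2
  have hint : Integrable (fun p : E × E ↦ (π * fderiv ℝ G p.1 p.2) ^ 2) (γ.prod γ) := by
    refine hbound.mono' hmeas.aestronglyMeasurable (.of_forall fun p ↦ ?_)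
    rw [Real.norm_of_nonneg (sq_nonneg _), ← mul_pow, ← sq_abs, abs_mul]
    have h1 : |fderiv ℝ G p.1 p.2| ≤ K * ‖p‖ :=
      ((fderiv ℝ G p.1).le_opNorm p.2).trans
        (mul_le_mul (hK _) (norm_snd_le p) (norm_nonneg _) K.2)
    refine pow_le_pow_left₀ (by positivity) ?_ 2
    rw [abs_of_pos Real.pi_pos]
    have := mul_le_mul_of_nonneg_left h1 Real.pi_pos.le
    have : 0 ≤ K * ‖p‖ * π := by positivity
    linarith
  rw [integral_prod _ hint]
  have hinner (x : E) : ∫ y, (π * fderiv ℝ G x y) ^ 2 ∂γ = π ^ 2 * ‖fderiv ℝ G x‖ ^ 2 := by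
    simp_rw [mul_pow]
    rw [integral_const_mul, ← variance_dual_stdGaussian, variance_of_integral_eq_zero
      (ContinuousLinearMap.continuous _).aemeasurable (integral_strongDual_stdGaussian _)]
  simp_rw [hinner]
  calc ∫ x, π ^ 2 * ‖fderiv ℝ G x‖ ^ 2 ∂γ ≤ ∫ x, π ^ 2 * (K : ℝ) ^ 2 ∂γ := by
        refine integral_mono_of_nonneg (.of_forall fun x ↦ by positivity) (integrable_const _)
          (.of_forall fun x ↦ ?_)
        have := hK x
        dsimp only
        gcongr
    _ = π ^ 2 * K ^ 2 := by simp

end Gaussian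

section Polar

variable {E : Type*} [NormedAddCommGroup E] [NormedSpace ℝ E] [FiniteDimensional ℝ E]
  [MeasurableSpace E] [BorelSpace E]

theorem integral_radial_mul_angular [Nontrivial E] (μ : Measure E) [μ.IsAddHaarMeasure]
    (φ : ℝ → ℝ) (H : E → ℝ) :
    ∫ x, φ ‖x‖ * H (‖x‖⁻¹ • x) ∂μ =
      (∫ s, H s ∂μ.toSphere) * ∫ r, φ r ∂(Measure.volumeIoiPow (Module.finrank ℝ E - 1)) := by
  calc ∫ x, φ ‖x‖ * H (‖x‖⁻¹ • x) ∂μ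
      = ∫ x : ({0}ᶜ : Set E), φ ‖x.1‖ * H (‖x.1‖⁻¹ • x.1) ∂(μ.comap (↑)) := by
        rw [integral_subtype_comap (measurableSet_singleton _).compl
          fun x ↦ φ ‖x‖ * H (‖x‖⁻¹ • x), restrict_compl_singleton]
    _ = ∫ p, H p.1 * φ p.2 ∂(μ.toSphere.prod (.volumeIoiPow (Module.finrank ℝ E - 1))) := by
        rw [← μ.measurePreserving_homeomorphUnitSphereProd.integral_comp
          (Homeomorph.measurableEmbedding _)]
        simp [mul_comm]
    _ = _ := integral_prod_mul (fun s : Metric.sphere (0 : E) 1 ↦ H s)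
          (fun r : Set.Ioi (0 : ℝ) ↦ φ r)

end Polar

section Sphere

variable {d : ℕ}

instance : IsProbabilityMeasure (ballUniform d) := by
  refine ⟨?_⟩
  rw [ballUniform, Measure.smul_apply, Measure.restrict_apply_univ, smul_eq_mul]
  exact ENNReal.inv_mul_cancel (Metric.measure_closedBall_pos _ _ one_pos).ne'
    measure_closedBall_lt_top.ne

theorem measurable_normalize :
    Measurable fun x : EuclideanSpace ℝ (Fin d) ↦ ‖x‖⁻¹ • x := by fun_prop

instance : IsProbabilityMeasure (sphereUniform d) :=
  Measure.isProbabilityMeasure_map measurable_normalize.aemeasurable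

theorem ballUniform_absolutelyContinuous : ballUniform d ≪ volume :=
  Measure.smul_absolutelyContinuous.trans Measure.restrict_le_self.absolutelyContinuous

theorem ae_norm_eq_one_sphereUniform (hd : 1 ≤ d) : ∀ᵐ u ∂(sphereUniform d), ‖u‖ = 1 := by
  have : Nonempty (Fin d) := ⟨⟨0, hd⟩⟩
  rw [sphereUniform, ae_map_iff measurable_normalize.aemeasurable
    (measurableSet_eq_fun measurable_norm measurable_const)]
  refine ballUniform_absolutelyContinuous.ae_le ?_
  filter_upwards [Measure.ae_ne volume 0] with x hx
  simp [norm_smul, hx]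

/-- Comparison of spherical and Gaussian averages through polar coordinates. -/
theorem integral_sphereUniform_eq_stdGaussian (hd : 1 ≤ d) {H : EuclideanSpace ℝ (Fin d) → ℝ}
    (hH : Measurable H) :
    d * ∫ u, H u ∂(sphereUniform d) =
      ∫ x, ‖x‖ ^ 2 * H (‖x‖⁻¹ • x) ∂(stdGaussian (EuclideanSpace ℝ (Fin d))) := by
  have : Nonempty (Fin d) := ⟨⟨0, hd⟩⟩
  set V : Measure (EuclideanSpace ℝ (Fin d)) := volume
  set B := Metric.closedBall (0 : EuclideanSpace ℝ (Fin d)) 1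
  set S : (EuclideanSpace ℝ (Fin d) → ℝ) → ℝ := fun H ↦ ∫ s, H s ∂V.toSphere
  obtain ⟨a, ha⟩ : ∃ a : ℝ, ∀ H : EuclideanSpace ℝ (Fin d) → ℝ,
      ∫ x in B, H (‖x‖⁻¹ • x) = S H * a := by
    refine ⟨∫ r, (Set.Iic (1 : ℝ)).indicator 1 r.1 ∂(Measure.volumeIoiPow
      (Module.finrank ℝ (EuclideanSpace ℝ (Fin d)) - 1)), fun H ↦ ?_⟩
    rw [← integral_radial_mul_angular V ((Set.Iic 1).indicator 1),
      ← integral_indicator measurableSet_closedBall]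
    congr with x
    by_cases hx : ‖x‖ ≤ 1 <;> simp [Set.indicator, hx]
  obtain ⟨b, hb⟩ : ∃ b : ℝ, ∀ H : EuclideanSpace ℝ (Fin d) → ℝ,
      ∫ x, ‖x‖ ^ 2 * H (‖x‖⁻¹ • x) ∂(stdGaussian (EuclideanSpace ℝ (Fin d))) = S H * b := by
    let φ : ℝ → ℝ := fun r ↦ (2 * π) ^ (-(d / 2 : ℝ)) * Real.exp (-(r ^ 2 / 2)) * r ^ 2
    refine ⟨∫ r, φ r.1 ∂(Measure.volumeIoiPow
      (Module.finrank ℝ (EuclideanSpace ℝ (Fin d)) - 1)), fun H ↦ ?_⟩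
    rw [← integral_radial_mul_angular V φ, stdGaussian_eq_withDensity,
      integral_withDensity_eq_integral_toReal_smul (by fun_prop) (by simp)]
    congr with x
    rw [ENNReal.toReal_ofReal (by positivity), finrank_euclideanSpace_fin, smul_eq_mul]
    ring
  have hσ : ∫ u, H u ∂(sphereUniform d) = (V.real B)⁻¹ * (S H * a) := by
    rw [sphereUniform, integral_map measurable_normalize.aemeasurable hH.aestronglyMeasurable,
      ballUniform, integral_smul_measure, ha, smul_eq_mul, ENNReal.toReal_inv]
    rfl
  have h1 : V.real B = S 1 * a := by
    rw [← ha]; simp [V]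
  have h2 : (d : ℝ) = S 1 * b := by
    rw [← hb]
    simp [integral_norm_sq_stdGaussian]
  have hB : V.real B ≠ 0 :=
    (ENNReal.toReal_pos (Metric.measure_closedBall_pos _ _ one_pos).ne'
      measure_closedBall_lt_top.ne).ne'
  rw [hb, hσ, h2, h1]
  rw [h1] at hB
  have ha0 := right_ne_zero_of_mul hB
  have hS0 := left_ne_zero_of_mul hB
  field_simp

/-- Poincaré-type inequality on the sphere for the odd part of a Lipschitz function. -/
theorem integral_sphereUniform_sq_sub_le (hd : 1 ≤ d) {f : EuclideanSpace ℝ (Fin d) → ℝ} {L δ : ℝ}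
    (hL : 0 ≤ L) (hδ : 0 ≤ δ) (hf : ∀ x y, |f x - f y| ≤ L * ‖x - y‖)
    (a : EuclideanSpace ℝ (Fin d)) :
    d * ∫ u, (f (a + δ • u) - f (a - δ • u)) ^ 2 ∂(sphereUniform d) ≤
      9 * π ^ 2 * (L * δ) ^ 2 := by
  lift L to ℝ≥0 using hL
  lift δ to ℝ≥0 using hδ
  set h : EuclideanSpace ℝ (Fin d) → ℝ := fun u ↦ f (a + (δ : ℝ) • u) - f (a - (δ : ℝ) • u)
    with hh
  have hnorm (w : EuclideanSpace ℝ (Fin d)) : ‖(δ : ℝ) • w‖ = δ * ‖w‖ := by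
    simp [norm_smul]
  have hA : LipschitzWith (2 * L * δ) h := by
    refine LipschitzWith.of_dist_le_mul fun u v ↦ ?_
    rw [Real.dist_eq, dist_eq_norm]
    have h1 := hf (a + (δ : ℝ) • u) (a + (δ : ℝ) • v)
    have h2 := hf (a - (δ : ℝ) • v) (a - (δ : ℝ) • u)
    rw [add_sub_add_left_eq_sub, ← smul_sub, hnorm] at h1
    rw [sub_sub_sub_cancel_left, ← smul_sub, hnorm] at h2
    calc |h u - h v| = |(f (a + (δ : ℝ) • u) - f (a + (δ : ℝ) • v)) +
          (f (a - (δ : ℝ) • v) - f (a - (δ : ℝ) • u))| := by rw [hh]; congr 1; ring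
      _ ≤ _ := abs_add_le _ _
      _ ≤ _ := add_le_add h1 h2
      _ = _ := by push_cast; ring
  have hB (u : EuclideanSpace ℝ (Fin d)) (hu : ‖u‖ = 1) : |h u| ≤ (2 * L * δ : ℝ≥0) := by
    refine (hf _ _).trans_eq ?_
    have : a + (δ : ℝ) • u - (a - (δ : ℝ) • u) = (δ : ℝ) • ((2 : ℝ) • u) := by module
    rw [this, hnorm, norm_smul, hu]
    push_cast
    norm_num
    ring
  have hodd (u : EuclideanSpace ℝ (Fin d)) : h (-u) = -h u := by
    simp [hh, sub_eq_add_neg, add_comm]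
  have hP := integral_sq_sub_neg_le (hA.norm_mul_comp_normalize hB)
  have hsq (x : EuclideanSpace ℝ (Fin d)) :
      (‖x‖ * h (‖x‖⁻¹ • x) - ‖-x‖ * h (‖-x‖⁻¹ • -x)) ^ 2 =
        4 * (‖x‖ ^ 2 * (h (‖x‖⁻¹ • x)) ^ 2) := by
    rw [norm_neg, smul_neg, hodd]; ring
  simp_rw [hsq] at hP
  rw [integral_const_mul, ← integral_sphereUniform_eq_stdGaussian hd
    (hA.continuous.measurable.pow_const 2)] at hP
  push_cast at hP
  linarith

end Sphere

/-- Second-moment bound for the (per-step) LAZOa gradient estimator (Lemma 4, part (a)):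
`E_u[‖g(u)‖²] ≤ c d L² + (2d²D²η²/δ²)‖v‖² + 8d²D²`. -/
theorem stmt7 :
    ∃ c : ℝ, 0 < c ∧
      ∀ (d : ℕ), 1 ≤ d → ∀ δ η D L : ℝ, 0 < δ → 0 < η → 0 < D → 0 ≤ L →
      ∀ ft ftm : EuclideanSpace ℝ (Fin d) → ℝ,
        (∀ x y, |ft x - ft y| ≤ L * ‖x - y‖) → (∀ x y, |ftm x - ftm y| ≤ L * ‖x - y‖) →
      ∀ xt xtm utm : EuclideanSpace ℝ (Fin d), ‖utm‖ = 1 →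
      ∀ v : EuclideanSpace ℝ (Fin d), ‖xt - xtm‖ ≤ η * ‖v‖ →
        (∫ u, ‖(if |ft (xt + δ • u) - ftm (xtm + δ • utm)| ≤
                  D * ‖xt - xtm + δ • (u - utm)‖ then
                ((d : ℝ) / δ * (ft (xt + δ • u) - ftm (xtm + δ • utm))) • u
              else
                ((d : ℝ) / (2 * δ) * (ft (xt + δ • u) - ft (xt - δ • u))) • u)‖ ^ 2
          ∂(sphereUniform d)) ≤
          c * d * L ^ 2 + 2 * (d : ℝ) ^ 2 * D ^ 2 * η ^ 2 / δ ^ 2 * ‖v‖ ^ 2 +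
            8 * (d : ℝ) ^ 2 * D ^ 2 := by
  refine ⟨9 * π ^ 2 / 4, by positivity, ?_⟩
  intro d hd δ η D L hδ hη hD hL ft ftm hft _ xt xtm utm hutm v hv
  have hd0 : (0 : ℝ) < d := by exact_mod_cast hd
  set R : ℝ := 2 * (d : ℝ) ^ 2 * D ^ 2 * η ^ 2 / δ ^ 2 * ‖v‖ ^ 2 + 8 * (d : ℝ) ^ 2 * D ^ 2
    with hRdef
  have hR : 0 ≤ R := by positivity
  have hmain := integral_sphereUniform_sq_sub_le hd hL hδ.le hft xt
  set h : EuclideanSpace ℝ (Fin d) → ℝ := fun u ↦ ft (xt + δ • u) - ft (xt - δ • u)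
  have hcont : Continuous ft :=
    (LipschitzWith.of_dist_le_mul (K := ⟨L, hL⟩) fun x y ↦ by
      rw [Real.dist_eq, dist_eq_norm]; exact hft x y).continuous
  have hint : Integrable (fun u ↦ h u ^ 2) (sphereUniform d) := by
    refine (integrable_const ((L * (2 * δ)) ^ 2)).mono'
      (Continuous.aestronglyMeasurable (by fun_prop)) ?_
    filter_upwards [ae_norm_eq_one_sphereUniform hd] with u hu
    rw [Real.norm_of_nonneg (sq_nonneg _), ← sq_abs]
    have : xt + δ • u - (xt - δ • u) = (2 * δ) • u := by module
    have h1 := hft (xt + δ • u) (xt - δ • u)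
    rw [this, norm_smul, hu, mul_one, Real.norm_of_nonneg (by positivity)] at h1
    exact pow_le_pow_left₀ (abs_nonneg _) h1 2
  calc _ ≤ ∫ u, (R + (d / (2 * δ)) ^ 2 * h u ^ 2) ∂(sphereUniform d) := by
        refine integral_mono_of_nonneg (.of_forall fun u ↦ sq_nonneg _)
          ((integrable_const R).add (hint.const_mul _)) ?_
        filter_upwards [ae_norm_eq_one_sphereUniform hd] with u hu
        split_ifs with hc
        · refine le_add_of_le_of_nonneg ?_ (by positivity)
          have hdist : ‖xt - xtm + δ • (u - utm)‖ ≤ η * ‖v‖ + 2 * δ := by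
            refine (norm_add_le _ _).trans (add_le_add hv ?_)
            rw [norm_smul, Real.norm_of_nonneg hδ.le, mul_comm]
            gcongr
            refine (norm_sub_le _ _).trans_eq ?_
            rw [hu, hutm]; norm_num
          have hle := hc.trans (mul_le_mul_of_nonneg_left hdist hD.le)
          have hsq := pow_le_pow_left₀ (abs_nonneg _) hle 2
          rw [sq_abs] at hsq
          rw [norm_smul, hu, mul_one, Real.norm_eq_abs, sq_abs, mul_pow]
          calc _ ≤ (d / δ) ^ 2 * (D * (η * ‖v‖ + 2 * δ)) ^ 2 := by gcongr
            _ ≤ (d / δ) ^ 2 * (D ^ 2 * (2 * (η * ‖v‖) ^ 2 + 8 * δ ^ 2)) := by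
                rw [mul_pow D]
                gcongr
                linarith [sq_nonneg (η * ‖v‖ - 2 * δ)]
            _ = R := by rw [hRdef]; field_simp
        · refine le_add_of_nonneg_of_le hR ?_
          rw [norm_smul, hu, mul_one, Real.norm_eq_abs, sq_abs, mul_pow]
    _ = R + (d / (2 * δ)) ^ 2 * ∫ u, h u ^ 2 ∂(sphereUniform d) := by
        rw [integral_add (integrable_const R) (hint.const_mul _), integral_const_mul]
        simp
    _ = R + d / (4 * δ ^ 2) * (d * ∫ u, h u ^ 2 ∂(sphereUniform d)) := by
        field_simp; ring
    _ ≤ R + d / (4 * δ ^ 2) * (9 * π ^ 2 * (L * δ) ^ 2) := by gcongr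
    _ = _ := by rw [hRdef]; field_simp; ring
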